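/- arXiv:2404.02178 — 3 statements merged into one kernel-verified Lean document; each statement's English description precedes it below -/
import Mathlib

section
/- Every additive abelian group G possesses the weak acyclic matching property: for all finite nonempty subsets A, B ⊆ G with |A| = |B| and A ∩ (A + B) = ∅, there exists an acyclic matching from A to B. -/
open Finset Pointwise

/-- A matching from `A` to `B` is a bijection `f : A → B` with `a + f a ∉ A` for all `a ∈ A`. -/
def IsMatchingFrom {G : Type*} [AddCommGroup G] (A B : Finset G) (f : A ≃ B) : Prop :=
  ∀ a : A, (a : G) + (f a : G) ∉ A

/-- The multiplicity function of a bijection `f : A → B`: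
`m_f x = |{a ∈ A : a + f a = x}|`. -/
noncomputable def multiplicityFn {G : Type*} [AddCommGroup G] (A B : Finset G)
    (f : A ≃ B) : G → ℕ :=
  fun x => Nat.card {a : A // (a : G) + (f a : G) = x}

/-- A matching `f : A → B` is acyclic if every matching `g : A → B` with `m_g = m_f`
equals `f`. -/
def IsAcyclicMatchingFrom {G : Type*} [AddCommGroup G] (A B : Finset G) (f : A ≃ B) : Prop :=
  IsMatchingFrom A B f ∧
    ∀ g : A ≃ B, IsMatchingFrom A B g → multiplicityFn A B g = multiplicityFn A B f → g = f

/-- Two finite sets of equal size in an abelian group admit a bijection which is determined by its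
multiplicities: pick `x ∈ A + B`, send every `a` with `x - a ∈ B` to `x - a`, and recurse on
what is left. -/
theorem exists_injOn_determined_by_multiplicities {G : Type*} [AddCommGroup G] [DecidableEq G]
    (n : ℕ) : ∀ A B : Finset G, A.card = n → B.card = n →
      ∃ f : G → G, Set.MapsTo f A B ∧ Set.InjOn f A ∧
        ∀ g : G → G, Set.MapsTo g A B → Set.InjOn g A →
          (∀ x, #{a ∈ A | a + g a = x} = #{a ∈ A | a + f a = x}) → Set.EqOn g f A := by
  induction n using Nat.strong_induction_on with
  | _ n ih =>
  intro A B hA hB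
  rcases A.eq_empty_or_nonempty with rfl | ⟨a₀, ha₀⟩
  · exact ⟨id, by simp [Set.MapsTo], by simp, by simp⟩
  have hBne : B.Nonempty := by
    rw [← card_pos, hB, ← hA]
    exact card_pos.mpr ⟨a₀, ha₀⟩
  obtain ⟨b₀, hb₀⟩ := hBne
  obtain ⟨x, hx⟩ : ∃ x, x = a₀ + b₀ := ⟨_, rfl⟩
  have hcard : #{a ∈ A | x - a ∈ B} = #{b ∈ B | x - b ∈ A} :=
    card_bij' (fun a _ => x - a) (fun b _ => x - b)
      (by simp +contextual) (by simp +contextual) (by simp) (by simp)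
  have hpos : 0 < #{a ∈ A | x - a ∈ B} :=
    card_pos.mpr ⟨a₀, by simp [ha₀, hx, hb₀]⟩
  have hsplitA := card_filter_add_card_filter_not (s := A) (fun a => x - a ∈ B)
  have hsplitB := card_filter_add_card_filter_not (s := B) (fun b => x - b ∈ A)
  obtain ⟨f, hfm, hfi, hfu⟩ := ih #{a ∈ A | x - a ∉ B} (by omega)
    {a ∈ A | x - a ∉ B} {b ∈ B | x - b ∉ A} rfl (by omega)
  have hfm' : ∀ a ∈ A, x - a ∉ B → f a ∈ B ∧ x - f a ∉ A := fun a ha hab => by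
    simpa using hfm (show a ∈ ((({a ∈ A | x - a ∉ B} : Finset G)) : Set G) by simp [ha, hab])
  refine ⟨fun a => if x - a ∈ B then x - a else f a, ?_, ?_, ?_⟩
  · intro a ha
    by_cases h : x - a ∈ B
    · simp [h]
    · simpa [h] using (hfm' a ha h).1
  · intro a ha b hb hab
    have ha' : a ∈ A := ha
    have hb' : b ∈ A := hb
    by_cases h : x - a ∈ B <;> by_cases k : x - b ∈ B <;> simp only [h, k, if_true, if_false] at hab
    · simpa using hab
    · exact absurd (by simpa [← hab] using ha') (hfm' b hb k).2
    · exact absurd (by simpa [hab] using hb') (hfm' a ha h).2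
    · exact hfi (by simp [ha', h]) (by simp [hb', k]) hab
  · intro g hgm hgi hg
    have hsub : {a ∈ A | a + g a = x} ⊆ {a ∈ A | x - a ∈ B} := by
      intro a ha
      obtain ⟨ha, h⟩ := mem_filter.mp ha
      exact mem_filter.mpr ⟨ha, by simpa [← h] using hgm ha⟩
    have hle : #{a ∈ A | x - a ∈ B} ≤ #{a ∈ A | a + g a = x} := by
      rw [hg x]
      refine card_le_card fun a ha => ?_
      obtain ⟨ha, h⟩ := mem_filter.mp ha
      simp [ha, h]
    have heq := eq_of_subset_of_card_le hsub hle
    have hgx : ∀ a ∈ A, x - a ∈ B → g a = x - a := fun a ha h => by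
      have : a ∈ ({a ∈ A | a + g a = x} : Finset G) := heq ▸ mem_filter.mpr ⟨ha, h⟩
      exact eq_sub_of_add_eq' (mem_filter.mp this).2
    have hrest : Set.EqOn g f ({a ∈ A | x - a ∉ B} : Finset G) := by
      refine hfu g ?_ (hgi.mono (by exact_mod_cast filter_subset _ A)) fun y => ?_
      · intro a ha
        obtain ⟨ha, h⟩ := mem_filter.mp ha
        refine mem_filter.mpr ⟨hgm ha, fun hc => h ?_⟩
        have hga : g a ∈ B := hgm ha
        have h1 : g (x - g a) = g a := by
          simpa using hgx (x - g a) hc (by simpa using hga)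
        have h2 : x - g a = a := hgi hc ha h1
        rwa [← h2, sub_sub_cancel]
      · have hy := hg y
        rw [← card_filter_add_card_filter_not (s := {a ∈ A | a + g a = y}) (fun a => x - a ∈ B),
          ← card_filter_add_card_filter_not
            (s := {a ∈ A | a + (if x - a ∈ B then x - a else f a) = y}) (fun a => x - a ∈ B)] at hy
        have e₁ : ({a ∈ {a ∈ A | a + g a = y} | x - a ∈ B} : Finset G) =
            {a ∈ {a ∈ A | a + (if x - a ∈ B then x - a else f a) = y} | x - a ∈ B} := by
          ext a
          simp only [mem_filter]
          grind
        have e₂ : ({a ∈ {a ∈ A | a + (if x - a ∈ B then x - a else f a) = y} | x - a ∉ B} :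
            Finset G) = {a ∈ {a ∈ A | x - a ∉ B} | a + f a = y} := by
          ext a
          simp only [mem_filter]
          grind
        rw [e₁, e₂] at hy
        rw [filter_comm]
        exact Nat.add_left_cancel hy
    intro a ha
    by_cases h : x - a ∈ B
    · simpa [h] using hgx a ha h
    · simpa [h] using hrest (mem_filter.mpr ⟨ha, h⟩)

theorem multiplicityFn_eq_card_filter {G : Type*} [AddCommGroup G] [DecidableEq G]
    {A B : Finset G} (e : A ≃ B) (f : G → G) (hf : ∀ a : A, f a = e a) (x : G) :
    multiplicityFn A B e x = #{a ∈ A | a + f a = x} := by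
  rw [multiplicityFn, ← Nat.card_eq_finsetCard]
  exact Nat.card_congr
    { toFun := fun a => ⟨a.1, by simp [hf a.1, a.2]⟩
      invFun := fun a => ⟨⟨a.1, (mem_filter.mp a.2).1⟩, by
        rw [← hf]
        exact (mem_filter.mp a.2).2⟩
      left_inv := fun _ => rfl
      right_inv := fun _ => rfl }

/-- Every abelian group possesses the weak acyclic matching property. -/
theorem abelianGroup_weak_acyclic_matching_property
    {G : Type*} [AddCommGroup G] [DecidableEq G]
    (A B : Finset G) (hA : A.Nonempty) (hB : B.Nonempty)
    (hcard : A.card = B.card) (hdisj : A ∩ (A + B) = ∅) :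
    ∃ f : A ≃ B, IsAcyclicMatchingFrom A B f := by
  obtain ⟨f, hfm, hfi, hfu⟩ :=
    exists_injOn_determined_by_multiplicities A.card A B rfl hcard.symm
  have hbij : Function.Bijective (fun a : A => (⟨f a, hfm a.2⟩ : B)) := by
    rw [Fintype.bijective_iff_injective_and_card]
    refine ⟨fun a b hab => Subtype.ext (hfi a.2 b.2 (congrArg Subtype.val hab)), by simpa⟩
  refine ⟨Equiv.ofBijective _ hbij, fun a ha => ?_, fun g _ hg => ?_⟩
  · have hmem := mem_inter.mpr ⟨ha, add_mem_add a.2 (Subtype.prop (Equiv.ofBijective _ hbij a))⟩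
    simp [hdisj] at hmem
  · let g' : G → G := fun a => if h : a ∈ A then g ⟨a, h⟩ else 0
    have hg' : ∀ a : A, g' a = g a := fun a => by simp [g']
    have heq : Set.EqOn g' f A := by
      refine hfu g' (fun a ha => ?_) (fun a ha b hb hab => ?_) fun x => ?_
      · rw [hg' ⟨a, ha⟩]
        exact (g ⟨a, ha⟩).2
      · rw [hg' ⟨a, ha⟩, hg' ⟨b, hb⟩] at hab
        exact congrArg Subtype.val (g.injective (Subtype.ext hab))
      · rw [← multiplicityFn_eq_card_filter g g' hg', hg,
          multiplicityFn_eq_card_filter _ f fun a => rfl]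
    ext a
    rw [← hg' a, heq a.2]
    rfl
end

section
/- Let p be a prime and let A be a subset of ℤ/pℤ of size k such that A ∩ 2A = ∅, where 2A = {2a : a ∈ A}, and k · 2^(k−1) < p. Then the identity map on A is an acyclic matching from A to itself: it is a matching, and every matching g : A → A with m_g = m_id equals the identity. -/
open Finset Pointwise

/-- The `0`-`1` matrix of a partial function. -/
def partialFunMatrix {ι : Type*} [DecidableEq ι] (w : ι → Option ι) : Matrix ι ι ℤ :=
  Matrix.of fun i j => if w i = some j then 1 else 0

theorem partialFunMatrix_nonneg {ι : Type*} [DecidableEq ι] (w : ι → Option ι) (i j : ι) :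
    0 ≤ partialFunMatrix w i j := by
  simp only [partialFunMatrix, Matrix.of_apply]
  split_ifs <;> norm_num

section PartialFunMatrix

variable {ι : Type*} [Fintype ι] [DecidableEq ι]

theorem partialFunMatrix_mul (w w' : ι → Option ι) :
    partialFunMatrix w * partialFunMatrix w' = partialFunMatrix fun i => (w i).bind w' := by
  ext i j
  cases h : w i <;> simp [partialFunMatrix, Matrix.mul_apply, h, -mul_ite]

theorem exists_partialFunMatrix_pow (w : ι → Option ι) (n : ℕ) :
    ∃ w', partialFunMatrix w ^ n = partialFunMatrix w' := by
  induction n with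
  | zero =>
    refine ⟨some, ?_⟩
    ext i j
    simp [partialFunMatrix, Matrix.one_apply]
  | succ n ih =>
    obtain ⟨w', h⟩ := ih
    exact ⟨_, by rw [pow_succ, h, partialFunMatrix_mul]⟩

theorem isNilpotent_partialFunMatrix_of_det_ne_zero (w : ι → Option ι)
    (h : (1 - partialFunMatrix w).det ≠ 0) : IsNilpotent (partialFunMatrix w) := by
  choose f hf using exists_partialFunMatrix_pow w
  obtain ⟨a, b, hab, hfab⟩ : ∃ a b, a < b ∧ f a = f b := by
    obtain ⟨a, b, hne, heq⟩ := Finite.exists_ne_map_eq_of_infinite f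
    rcases lt_or_gt_of_ne hne with hlt | hlt
    exacts [⟨a, b, hlt, heq⟩, ⟨b, a, hlt, heq.symm⟩]
  obtain ⟨d, rfl⟩ := Nat.exists_eq_add_of_lt hab
  set W := partialFunMatrix w
  have hpow : W ^ a = W ^ (a + (d + 1)) := by rw [hf, hfab, ← hf, add_assoc]
  have hmul : (W ^ a * ∑ i ∈ range (d + 1), W ^ i) * (1 - W) = 0 := by
    rw [mul_assoc, geom_sum_mul_neg, mul_sub, mul_one, ← pow_add, ← hpow, sub_self]
  have hzero : W ^ a * ∑ i ∈ range (d + 1), W ^ i = 0 :=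
    Matrix.ext fun i => congrFun (Matrix.eq_zero_of_vecMul_eq_zero h
      (by rw [← Matrix.mul_apply_eq_vecMul, hmul]; rfl))
  refine ⟨a, ?_⟩
  ext i j
  have hentry := congrFun (congrFun hzero i) j
  rw [mul_sum, Matrix.sum_apply] at hentry
  have hnonneg : ∀ n ∈ range (d + 1), 0 ≤ (W ^ a * W ^ n) i j := fun n _ => by
    rw [← pow_add, hf]
    exact partialFunMatrix_nonneg _ i j
  simpa using (sum_eq_zero_iff_of_nonneg hnonneg).1 hentry 0 (by simp)

theorem abs_det_one_sub_partialFunMatrix_le_one (w : ι → Option ι) :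
    |(1 - partialFunMatrix w).det| ≤ 1 := by
  by_cases h : (1 - partialFunMatrix w).det = 0
  · simp [h]
  · have hunit := (isNilpotent_partialFunMatrix_of_det_ne_zero w h).isUnit_one_sub
    rw [Matrix.isUnit_iff_isUnit_det, Int.isUnit_iff_abs_eq] at hunit
    exact hunit.le

theorem abs_det_add_le_two_pow_card (w w' : ι → Option ι) :
    |((1 - partialFunMatrix w) + (1 - partialFunMatrix w')).det| ≤ 2 ^ Fintype.card ι := by
  set M := 1 - partialFunMatrix w
  set M' := 1 - partialFunMatrix w'
  have hrows (s : Finset ι) :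
      s.piecewise M M' = (1 - partialFunMatrix (s.piecewise w w') : Matrix ι ι ℤ) := by
    ext i j
    by_cases hi : i ∈ s
    · refine (congrFun (piecewise_eq_of_mem s M M' hi) j).trans ?_
      simp [M, partialFunMatrix, hi]
    · refine (congrFun (piecewise_eq_of_notMem s M M' hi) j).trans ?_
      simp [M', partialFunMatrix, hi]
  have hdet : (M + M').det =
      ∑ s : Finset ι, (1 - partialFunMatrix (s.piecewise w w')).det := by
    simp only [← hrows]
    exact (Matrix.detRowAlternating (n := ι) (R := ℤ)).toMultilinearMap.map_add_univ M M'
  rw [hdet]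
  calc _ ≤ ∑ s : Finset ι, |(1 - partialFunMatrix (s.piecewise w w')).det| :=
        abs_sum_le_sum_abs _ _
    _ ≤ ∑ _s : Finset ι, (1 : ℤ) :=
        sum_le_sum fun s _ => abs_det_one_sub_partialFunMatrix_le_one _
    _ = 2 ^ Fintype.card ι := by simp

end PartialFunMatrix

/-- A function on a finite set which vanishes wherever it fails to be the average of its
translates under two permutations is invariant under both. -/
theorem invariant_of_mul_two_mul_sub_sub_eq_zero {ι : Type*} [Fintype ι] (u v : Equiv.Perm ι)
    (y : ι → ℤ) (h : ∀ i, y i * (2 * y i - y (u i) - y (v i)) = 0) (i : ι) :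
    y (u i) = y i ∧ y (v i) = y i := by
  have hu : ∑ j, y (u j) ^ 2 = ∑ j, y j ^ 2 := Equiv.sum_comp u fun j => y j ^ 2
  have hv : ∑ j, y (v j) ^ 2 = ∑ j, y j ^ 2 := Equiv.sum_comp v fun j => y j ^ 2
  have hsum : ∑ j, ((y (u j) - y j) ^ 2 + (y (v j) - y j) ^ 2) = 0 := by
    have hterm (j : ι) : (y (u j) - y j) ^ 2 + (y (v j) - y j) ^ 2 =
        (y (u j) ^ 2 - y j ^ 2) + (y (v j) ^ 2 - y j ^ 2) := by
      linear_combination 2 * h j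
    simp only [hterm, sum_add_distrib, sum_sub_distrib, hu, hv, sub_self, add_zero]
  have hi := (sum_eq_zero_iff_of_nonneg fun j _ => by positivity).1 hsum i (mem_univ i)
  constructor <;> nlinarith [sq_nonneg (y (u i) - y i), sq_nonneg (y (v i) - y i)]

/-- Modulo a prime `p > 2 ^ |ι|`, a function on `ι` which is the average of its translates
under two permutations is invariant under both. -/
theorem invariant_of_two_mul_eq_add {ι : Type*} [Fintype ι] (p : ℕ) [Fact p.Prime]
    (hp : 2 ^ Fintype.card ι < p) (u v : Equiv.Perm ι) (x : ι → ZMod p)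
    (h : ∀ i, 2 * x i = x (u i) + x (v i)) (i : ι) :
    x (u i) = x i ∧ x (v i) = x i := by
  classical
  let r : ι → ι → Prop := fun a b => b = u a ∨ b = v a
  let rep : ι → ι := fun a => (Quot.mk r a).out
  have hrep_mk (a : ι) : Quot.mk r (rep a) = Quot.mk r a := Quot.out_eq _
  have hrep_u (a : ι) : rep (u a) = rep a :=
    congrArg Quot.out (Quot.sound (r := r) (Or.inl rfl : r a (u a))).symm
  have hrep_v (a : ι) : rep (v a) = rep a :=
    congrArg Quot.out (Quot.sound (r := r) (Or.inr rfl : r a (v a))).symm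
  have hrep_rep (a : ι) : rep (rep a) = rep a := congrArg Quot.out (hrep_mk a)
  let N : Matrix ι ι ℤ :=
    (1 - partialFunMatrix fun a => if rep a = a then none else some (u a)) +
      (1 - partialFunMatrix fun a => if rep a = a then none else some (v a))
  have hN (R : Type) [CommRing R] (y : ι → R) (a : ι) :
      (N.map (Int.cast : ℤ → R)).mulVec y a =
        if rep a = a then 2 * y a else 2 * y a - y (u a) - y (v a) := by
    split_ifs with ha
    · simp [N, Matrix.mulVec, dotProduct, partialFunMatrix, ha, Matrix.one_apply, add_mul,
        sum_add_distrib, two_mul]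
    · simp [N, Matrix.mulVec, dotProduct, partialFunMatrix, ha, Matrix.one_apply, add_mul,
        sub_mul, sum_add_distrib, two_mul]
      ring
  have hdet : N.det ≠ 0 := by
    intro h0
    obtain ⟨y, hy, hNy⟩ := Matrix.exists_mulVec_eq_zero_iff.2 h0
    have hrow (a : ι) : (if rep a = a then 2 * y a else 2 * y a - y (u a) - y (v a)) = 0 := by
      rw [← hN ℤ y a]
      exact congrFun hNy a
    have hinv := invariant_of_mul_two_mul_sub_sub_eq_zero u v y fun a => by
      have ha := hrow a
      split_ifs at ha
      · rw [show y a = 0 by lia, zero_mul]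
      · rw [ha, mul_zero]
    have hconst (a b : ι) (hab : r a b) : y a = y b := by
      rcases hab with rfl | rfl
      exacts [(hinv a).1.symm, (hinv a).2.symm]
    refine hy (funext fun a => ?_)
    have hya : y (rep a) = y a := congrArg (Quot.lift y hconst) (hrep_mk a)
    have h2 := hrow (rep a)
    rw [if_pos (hrep_rep a)] at h2
    simp only [Pi.zero_apply]
    lia
  have hdet_p : (N.map (Int.cast : ℤ → ZMod p)).det ≠ 0 := by
    have hcast : (N.map (Int.cast : ℤ → ZMod p)).det = (N.det : ZMod p) :=
      ((Int.castRingHom (ZMod p)).map_det N).symm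
    rw [hcast, Ne, ZMod.intCast_zmod_eq_zero_iff_dvd]
    intro hdvd
    have hle : |N.det| ≤ 2 ^ Fintype.card ι := abs_det_add_le_two_pow_card _ _
    have hlt : |N.det| < (p : ℤ) := hle.trans_lt (by exact_mod_cast hp)
    exact hdet (Int.eq_zero_of_abs_lt_dvd hdvd hlt)
  have hzero : (fun a => x a - x (rep a)) = 0 := by
    refine Matrix.eq_zero_of_mulVec_eq_zero hdet_p (funext fun a => ?_)
    rw [hN]
    split_ifs with ha
    · simp [ha]
    · rw [hrep_u, hrep_v, Pi.zero_apply]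
      linear_combination h a
  have hx (a : ι) : x a = x (rep a) := sub_eq_zero.1 (congrFun hzero a)
  exact ⟨by rw [hx, hrep_u, ← hx], by rw [hx, hrep_v, ← hx]⟩

/-- Let `p` be a prime and `A ⊆ ℤ/pℤ` of size `k` with `A ∩ 2A = ∅` and
`k · 2^(k-1) < p`. Then the identity map on `A` is an acyclic matching from `A` to
itself. -/
theorem identity_acyclic_matching (p : ℕ) (hp : p.Prime)
    (A : Finset (ZMod p)) (k : ℕ) (hk : A.card = k)
    (h2A : A ∩ A.image (fun a => 2 * a) = ∅)
    (hkp : k * 2 ^ (k - 1) < p) :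
    IsAcyclicMatchingFrom A A (Equiv.refl A) := by
  have := Fact.mk hp
  refine ⟨fun a ha => ?_, fun g _ hm => ?_⟩
  · have hmem : (a : ZMod p) + a ∈ A ∩ A.image (fun a => 2 * a) :=
      mem_inter.2 ⟨ha, mem_image.2 ⟨a, a.2, two_mul _⟩⟩
    simp [h2A] at hmem
  · have hcard : Fintype.card A = k := by simpa using hk
    rcases Nat.lt_or_ge k 2 with hk2 | hk2
    · have : Subsingleton A := Fintype.card_le_one_iff_subsingleton.1 (by lia)
      exact Subsingleton.elim _ _
    have hpow : 2 ^ k < p := by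
      calc 2 ^ k = 2 * 2 ^ (k - 1) := by rw [← pow_succ']; congr 1; lia
        _ ≤ k * 2 ^ (k - 1) := Nat.mul_le_mul_right _ hk2
        _ < p := hkp
    have htwo : (2 : ZMod p) ≠ 0 := by
      have hlt : 2 < p := by
        calc 2 < 2 ^ 2 := by norm_num
          _ ≤ 2 ^ k := Nat.pow_le_pow_right (by norm_num) hk2
          _ < p := hpow
      have hndvd : ¬ p ∣ 2 := fun hd => absurd (Nat.le_of_dvd (by norm_num) hd) (by lia)
      exact_mod_cast mt (ZMod.natCast_eq_zero_iff 2 p).1 hndvd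
    have hex (b : A) : ∃ a : A, (a : ZMod p) + g a = 2 * b := by
      have hb := congrFun hm (2 * (b : ZMod p))
      have : Nonempty {a : A // (a : ZMod p) + (Equiv.refl A a : ZMod p) = 2 * b} :=
        ⟨⟨b, (two_mul _).symm⟩⟩
      have hpos : 0 < multiplicityFn A A g (2 * (b : ZMod p)) := hb ▸ Nat.card_pos
      obtain ⟨⟨a, ha⟩⟩ := (Nat.card_pos_iff.1 hpos).1
      exact ⟨a, ha⟩
    choose f hf using hex
    have hf_inj : Function.Injective f := fun b c hbc =>
      Subtype.ext (mul_left_cancel₀ htwo (by rw [← hf b, ← hf c, hbc]))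
    let u : Equiv.Perm A := Equiv.ofBijective f (Finite.injective_iff_bijective.1 hf_inj)
    have hinv := invariant_of_two_mul_eq_add p (hcard ▸ hpow) u (u.trans g)
      (fun a => (a : ZMod p)) fun a => (hf a).symm
    ext a
    have hu : u a = a := Subtype.ext (hinv a).1
    have hg := (hinv a).2
    rw [Equiv.trans_apply, hu] at hg
    exact hg
end

section
/- Let p be a prime and let A, B be nonempty subsets of ℤ/pℤ with 0 ∉ B and |A| = |B| = k, where k ≤ √(log₂ p) − 1. Then there exists an acyclic matching from A to B. -/
open Finset Pointwise

/-- A finite set of weighted pairs contains a partial matching such that every pair meets a pair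
of the matching of at most the same weight. -/
theorem exists_greedy_matching {α β ι : Type*} [DecidableEq α] [DecidableEq β] [LinearOrder ι]
    (w : α × β → ι) (P : Finset (α × β)) :
    ∃ M ⊆ P, (∀ u ∈ M, ∀ v ∈ M, u.1 = v.1 ∨ u.2 = v.2 → u = v) ∧
      ∀ u ∈ P, ∃ v ∈ M, (v.1 = u.1 ∨ v.2 = u.2) ∧ w v ≤ w u := by
  induction P using Finset.strongInduction with
  | H P ih =>
    rcases P.eq_empty_or_nonempty with rfl | hP
    · exact ⟨∅, by simp⟩
    obtain ⟨m, hm, hmin⟩ := P.exists_min_image w hP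
    have hss : P.filter (fun v => v.1 ≠ m.1 ∧ v.2 ≠ m.2) ⊂ P :=
      Finset.filter_ssubset.2 ⟨m, hm, by simp⟩
    obtain ⟨M, hMP, hM, hdom⟩ := ih _ hss
    have hMm : ∀ v ∈ M, v ∈ P ∧ v.1 ≠ m.1 ∧ v.2 ≠ m.2 := fun v hv => by
      simpa using hMP hv
    refine ⟨insert m M, ?_, ?_, ?_⟩
    · intro v hv
      rcases Finset.mem_insert.1 hv with rfl | hv
      · exact hm
      · exact (hMm v hv).1
    · intro u hu v hv huv
      rcases Finset.mem_insert.1 hu with hu' | hu' <;>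
        rcases Finset.mem_insert.1 hv with hv' | hv'
      · rw [hu', hv']
      · subst hu'
        have := hMm v hv'
        rcases huv with h | h
        · exact absurd h.symm this.2.1
        · exact absurd h.symm this.2.2
      · subst hv'
        have := hMm u hu'
        rcases huv with h | h
        · exact absurd h this.2.1
        · exact absurd h this.2.2
      · exact hM u hu' v hv' huv
    · intro u hu
      by_cases h : u.1 ≠ m.1 ∧ u.2 ≠ m.2
      · obtain ⟨v, hv, h1, h2⟩ := hdom u (Finset.mem_filter.2 ⟨hu, h⟩)
        exact ⟨v, Finset.mem_insert_of_mem hv, h1, h2⟩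
      · refine ⟨m, Finset.mem_insert_self _ _, ?_, hmin u hu⟩
        by_contra! h'
        exact h ⟨h'.1.symm, h'.2.symm⟩

/-- `f` restricts to an acyclic matching from `A` to `B`, where the multiplicity function is
encoded as the multiset of sums. -/
def IsAcyclicOn {G : Type*} [AddCommGroup G] (A B : Finset G) (f : G → G) : Prop :=
  Set.BijOn f A B ∧ (∀ a ∈ A, a + f a ∉ A) ∧
    ∀ g : G → G, Set.BijOn g A B → (∀ a ∈ A, a + g a ∉ A) →
      A.val.map (fun a => a + g a) = A.val.map (fun a => a + f a) → Set.EqOn g f A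

section OrderedGroup

variable {G : Type*} [AddCommGroup G] [LinearOrder G]

/-- `f` maps `A` bijectively onto `B`, no `a + f a` lies in `A`, and no admissible pair `(a, b)`
has a sum smaller than both sums of the pairs of `f` that contain `a` and `b`. -/
structure IsStableMatchingOn (A B : Finset G) (f : G → G) : Prop where
  bijOn : Set.BijOn f A B
  add_notMem : ∀ a ∈ A, a + f a ∉ A
  stable : ∀ a ∈ A, ∀ b ∈ B, a + b ∉ A → f a ≤ b ∨ ∃ a' ∈ A, a' ≤ a ∧ f a' = b

variable [IsOrderedAddMonoid G]

theorem exists_isStableMatchingOn (A B : Finset G) (hcard : A.card = B.card)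
    (hB : ∀ b ∈ B, 0 < b) : ∃ f, IsStableMatchingOn A B f := by
  obtain ⟨M, hMP, hM, hdom⟩ := exists_greedy_matching (fun u : G × G => u.1 + u.2)
    ((A ×ˢ B).filter (fun u => u.1 + u.2 ∉ A))
  simp only [Prod.forall, Prod.exists, Finset.subset_iff, Finset.mem_filter,
    Finset.mem_product] at hMP hM hdom
  have hall : ∀ a ∈ A, ∃ b, (a, b) ∈ M := by
    by_contra! hne
    obtain ⟨a₀, ha₀, hun₀⟩ := hne
    classical
    obtain ⟨a, haU, hmax⟩ := (A.filter (fun a => ∀ b, (a, b) ∉ M)).exists_max_image id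
      ⟨a₀, Finset.mem_filter.2 ⟨ha₀, hun₀⟩⟩
    obtain ⟨haA, hun⟩ := Finset.mem_filter.1 haU
    have hfst : (M.image Prod.fst).card = M.card :=
      Finset.card_image_of_injOn fun u hu v hv h => hM _ _ hu _ _ hv (Or.inl h)
    have hsnd : (M.image Prod.snd).card = M.card :=
      Finset.card_image_of_injOn fun u hu v hv h => hM _ _ hu _ _ hv (Or.inr h)
    have hlt : (M.image Prod.fst).card < A.card := by
      refine Finset.card_lt_card ⟨fun x hx => ?_, fun hs => ?_⟩
      · obtain ⟨⟨x, y⟩, hxy, rfl⟩ := Finset.mem_image.1 hx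
        exact (hMP _ _ hxy).1.1
      · obtain ⟨⟨x, y⟩, hxy, rfl⟩ := Finset.mem_image.1 (hs haA)
        exact hun y hxy
    obtain ⟨b₀, hb₀, hb₀M⟩ := Finset.exists_mem_notMem_of_card_lt_card
      (show (M.image Prod.snd).card < B.card by omega)
    have hb₀M' : ∀ x, (x, b₀) ∉ M := fun x hx => hb₀M (Finset.mem_image.2 ⟨_, hx, rfl⟩)
    set S := B.filter (fun b => a + b ∈ A) with hS
    have hb₀S : b₀ ∈ S := by
      refine Finset.mem_filter.2 ⟨hb₀, ?_⟩
      by_contra hnot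
      obtain ⟨x, y, hxy, h | h, -⟩ := hdom a b₀ ⟨⟨haA, hb₀⟩, hnot⟩
      · exact hun y (h ▸ hxy)
      · exact hb₀M' x (h ▸ hxy)
    have hpartner : ∀ s ∈ S, ∃ y, (a + s, y) ∈ M := by
      intro s hs
      obtain ⟨hsB, hsA⟩ := Finset.mem_filter.1 hs
      by_contra! hno
      have := hmax _ (Finset.mem_filter.2 ⟨hsA, hno⟩)
      exact absurd this (not_le.2 (lt_add_of_pos_right a (hB s hsB)))
    choose! h hh using hpartner
    have hmaps : ∀ s ∈ S, h s ∈ S.erase b₀ := by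
      intro s hs
      have hsM := hh s hs
      refine Finset.mem_erase.2 ⟨fun he => hb₀M' _ (he ▸ hsM), Finset.mem_filter.2
        ⟨(hMP _ _ hsM).1.2, ?_⟩⟩
      by_contra hnot
      obtain ⟨x, y, hxy, h' | h', hle⟩ := hdom a (h s) ⟨⟨haA, (hMP _ _ hsM).1.2⟩, hnot⟩
      · exact hun y (h' ▸ hxy)
      · have := hM _ _ hxy _ _ hsM (Or.inr h')
        simp only [Prod.mk.injEq] at this
        rw [this.1, this.2] at hle
        have hpos := hB s (Finset.mem_filter.1 hs).1
        simp only [add_le_add_iff_right] at hle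
        exact absurd hle (not_le.2 (lt_add_of_pos_right a hpos))
    have hle := Finset.card_le_card_of_injOn h hmaps (fun s hs s' hs' he => by
      have := hM _ _ (hh s hs) _ _ (hh s' hs') (Or.inr he)
      simpa using congrArg Prod.fst this)
    exact absurd hle (not_le.2 (Finset.card_erase_lt_of_mem hb₀S))
  choose! f hf using hall
  have hinj : Set.InjOn f A := fun a ha a' ha' h =>
    congrArg Prod.fst (hM _ _ (hf a ha) _ _ (hf a' ha') (Or.inr h))
  have hmap : Set.MapsTo f A B := fun a ha => (hMP _ _ (hf a ha)).1.2
  refine ⟨f, ⟨hmap, hinj, Finset.surjOn_of_injOn_of_card_le f hmap hinj hcard.ge⟩,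
    fun a ha => (hMP _ _ (hf a ha)).2, fun a ha b hb hab => ?_⟩
  obtain ⟨x, y, hxy, h, hle⟩ := hdom a b ⟨⟨ha, hb⟩, hab⟩
  have hxA := (hMP _ _ hxy).1.1
  have hy : f x = y := congrArg Prod.snd (hM _ _ (hf x hxA) _ _ hxy (Or.inl rfl))
  rcases h with rfl | rfl
  · left
    rw [hy]
    simpa using hle
  · right
    exact ⟨x, hxA, by simpa using hle, hy⟩

theorem IsStableMatchingOn.eqOn {A B : Finset G} {f g : G → G} (hf : IsStableMatchingOn A B f)
    (hg : Set.BijOn g A B) (hgA : ∀ a ∈ A, a + g a ∉ A)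
    (hm : A.val.map (fun a => a + g a) = A.val.map (fun a => a + f a)) : Set.EqOn g f A := by
  by_contra hne
  simp only [Set.EqOn, not_forall] at hne
  obtain ⟨a₀, ha₀, hne₀⟩ := hne
  obtain ⟨a, ha, hmin⟩ := (A.filter (fun a => g a ≠ f a)).exists_min_image (fun a => a + f a)
    ⟨a₀, Finset.mem_filter.2 ⟨ha₀, hne₀⟩⟩
  obtain ⟨haA, hane⟩ := Finset.mem_filter.1 ha
  have hlow : ∀ x ∈ A, x + f x < a + f a → g x = f x := by
    intro x hx hlt
    by_contra h
    exact absurd (hmin x (Finset.mem_filter.2 ⟨hx, h⟩)) (not_le.2 hlt)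
  have hsub : A.filter (fun x => a + f a = x + g x) ⊆ A.filter (fun x => a + f a = x + f x) := by
    intro x hx
    obtain ⟨hxA, hx⟩ := Finset.mem_filter.1 hx
    refine Finset.mem_filter.2 ⟨hxA, ?_⟩
    rcases hf.stable x hxA (g x) (hg.mapsTo hxA) (hgA x hxA) with h | ⟨y, hyA, hyx, hy⟩
    · rcases h.eq_or_lt with h | h
      · rw [hx, h]
      · rw [hx, hlow x hxA (by rw [hx]; gcongr)]
    · rcases hyx.eq_or_lt with rfl | hlt
      · rw [hx, hy]
      · have := hlow y hyA (by rw [hx, hy]; gcongr)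
        exact absurd (hg.injOn hyA hxA (this.trans hy)) hlt.ne
  have hcard := congrArg (Multiset.count (a + f a)) hm
  rw [Multiset.count_map, Multiset.count_map] at hcard
  have heq := Finset.eq_of_subset_of_card_le hsub hcard.ge
  have hmem : a ∈ A.filter (fun x => a + f a = x + g x) := by
    rw [heq]
    exact Finset.mem_filter.2 ⟨haA, rfl⟩
  exact hane (add_left_cancel (Finset.mem_filter.1 hmem).2).symm

theorem exists_isAcyclicOn_of_pos (A B : Finset G) (hcard : A.card = B.card)
    (hB : ∀ b ∈ B, 0 < b) : ∃ f, IsAcyclicOn A B f := by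
  obtain ⟨f, hf⟩ := exists_isStableMatchingOn A B hcard hB
  exact ⟨f, hf.bijOn, hf.add_notMem, fun _ => hf.eqOn⟩

theorem exists_isAcyclicOn_of_neg (A B : Finset G) (hcard : A.card = B.card)
    (hB : ∀ b ∈ B, b < 0) : ∃ f, IsAcyclicOn A B f :=
  exists_isAcyclicOn_of_pos (G := Gᵒᵈ) A B hcard hB

end OrderedGroup

theorem Int.exists_card_filter_lt_eq (A : Finset ℤ) (n : ℕ) (hn : n ≤ A.card) :
    ∃ c, (A.filter (c < ·)).card = n := by
  induction n with
  | zero =>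
    obtain ⟨c, hc⟩ := A.exists_le
    exact ⟨c, by simpa [Finset.filter_eq_empty_iff] using hc⟩
  | succ n ih =>
    obtain ⟨c, hc⟩ := ih (by omega)
    have hne : (A.filter (fun a => ¬ c < a)).Nonempty := by
      rw [← Finset.card_pos]
      have := Finset.card_filter_add_card_filter_not (s := A) (c < ·)
      omega
    obtain ⟨m, hm, hmax⟩ := Finset.exists_max_image _ id hne
    obtain ⟨hmA, hmc⟩ := Finset.mem_filter.1 hm
    refine ⟨m - 1, ?_⟩
    have : A.filter (m - 1 < ·) = insert m (A.filter (c < ·)) := by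
      ext x
      simp only [Finset.mem_filter, Finset.mem_insert]
      constructor
      · rintro ⟨hx, hlt⟩
        by_cases hcx : c < x
        · exact Or.inr ⟨hx, hcx⟩
        · have := hmax x (Finset.mem_filter.2 ⟨hx, hcx⟩)
          simp only [id] at this
          left; omega
      · rintro (rfl | ⟨hx, hlt⟩)
        · exact ⟨hmA, by omega⟩
        · exact ⟨hx, by omega⟩
    rw [this, Finset.card_insert_of_notMem (by simp [hmc]), hc]

/-- A bijection whose sums have the same excess over `c` as a sign-respecting bijection
respects signs relative to `c` on the elements above `c`. -/
theorem Int.pos_of_map_add_eq {A B : Finset ℤ} (hB0 : (0 : ℤ) ∉ B) {c : ℤ} {f g : ℤ → ℤ}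
    (hf : Set.BijOn f A B) (hg : Set.BijOn g A B) (hfp : ∀ a ∈ A, c < a → 0 < f a)
    (hfn : ∀ a ∈ A, a ≤ c → f a < 0)
    (hm : A.val.map (fun a => a + g a) = A.val.map (fun a => a + f a)) :
    ∀ a ∈ A, c < a → 0 < g a := by
  have hsum : ∑ a ∈ A, max (a + g a - c) 0 = ∑ a ∈ A, max (a + f a - c) 0 := by
    have := congrArg (fun s => (s.map (fun x : ℤ => max (x - c) 0)).sum) hm
    rw [Multiset.map_map, Multiset.map_map] at this
    exact this
  have hfB : ∑ a ∈ A, max (f a) 0 = ∑ b ∈ B, max b 0 :=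
    Finset.sum_nbij f (fun a ha => hf.mapsTo ha) hf.injOn hf.surjOn fun _ _ => rfl
  have hgB : ∑ a ∈ A, max (g a) 0 = ∑ b ∈ B, max b 0 :=
    Finset.sum_nbij g (fun a ha => hg.mapsTo ha) hg.injOn hg.surjOn fun _ _ => rfl
  have hfs : ∑ a ∈ A, max (a + f a - c) 0 = ∑ a ∈ A, (max (a - c) 0 + max (f a) 0) := by
    refine Finset.sum_congr rfl fun a ha => ?_
    rcases lt_or_ge c a with h | h
    · have := hfp a ha h
      omega
    · have := hfn a ha h
      omega
  have hgs : ∑ a ∈ A, max (a + g a - c) 0 = ∑ a ∈ A, (max (a - c) 0 + max (g a) 0) := by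
    rw [hsum, hfs, Finset.sum_add_distrib, Finset.sum_add_distrib, hfB, hgB]
  have hterm := (Finset.sum_eq_sum_iff_of_le fun a _ => by omega).1 hgs
  intro a ha hca
  have h0 : g a ≠ 0 := fun h => hB0 (h ▸ hg.mapsTo ha)
  have := hterm a ha
  omega

theorem Set.BijOn.filter_of_card_eq {α β : Type*} {A : Finset α} {B : Finset β} {f : α → β}
    (hf : Set.BijOn f A B) (P : α → Prop) (Q : β → Prop) [DecidablePred P] [DecidablePred Q]
    (hPQ : ∀ a ∈ A, P a → Q (f a)) (hcard : (A.filter P).card = (B.filter Q).card) :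
    Set.BijOn f (A.filter P) (B.filter Q) ∧
      Set.BijOn f (A.filter (¬ P ·)) (B.filter (¬ Q ·)) := by
  have hmaps : Set.MapsTo f (A.filter P) (B.filter Q) := fun a ha => by
    simp only [Finset.coe_filter, Set.mem_ofPred_eq] at ha ⊢
    exact ⟨hf.mapsTo ha.1, hPQ a ha.1 ha.2⟩
  have hinj : Set.InjOn f (A.filter P) := hf.injOn.mono (Finset.coe_subset.2 (Finset.filter_subset _ _))
  have hbij : Set.BijOn f (A.filter P) (B.filter Q) :=
    ⟨hmaps, hinj, Finset.surjOn_of_injOn_of_card_le f hmaps hinj hcard.ge⟩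
  refine ⟨hbij, ?_, hf.injOn.mono (Finset.coe_subset.2 (Finset.filter_subset _ _)), ?_⟩
  · intro a ha
    simp only [Finset.coe_filter, Set.mem_ofPred_eq] at ha ⊢
    refine ⟨hf.mapsTo ha.1, fun hq => ha.2 ?_⟩
    obtain ⟨a', ha', he⟩ := hbij.surjOn
      (show f a ∈ (B.filter Q : Set β) by simpa using ⟨hf.mapsTo ha.1, hq⟩)
    simp only [Finset.coe_filter, Set.mem_ofPred_eq] at ha'
    exact hf.injOn ha'.1 ha.1 he ▸ ha'.2
  · intro b hb
    simp only [Finset.coe_filter, Set.mem_ofPred_eq] at hb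
    obtain ⟨a, ha, rfl⟩ := hf.surjOn hb.1
    refine ⟨a, ?_, rfl⟩
    simp only [Finset.coe_filter, Set.mem_ofPred_eq]
    exact ⟨ha, fun hP => hb.2 (hPQ a ha hP)⟩

theorem Int.exists_isAcyclicOn (A B : Finset ℤ) (hcard : A.card = B.card)
    (hB0 : (0 : ℤ) ∉ B) :
    ∃ f, IsAcyclicOn A B f := by
  obtain ⟨c, hc⟩ := Int.exists_card_filter_lt_eq A (B.filter (0 < ·)).card
    (hcard ▸ Finset.card_filter_le _ _)
  have hnotA : A.filter (fun a => ¬ c < a) = A.filter (· ≤ c) :=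
    Finset.filter_congr fun a _ => not_lt
  have hnotB : B.filter (fun b => ¬ 0 < b) = B.filter (· < 0) :=
    Finset.filter_congr fun b hb => by
      have : b ≠ 0 := fun h => hB0 (h ▸ hb)
      omega
  have hc' : (A.filter (· ≤ c)).card = (B.filter (· < 0)).card := by
    have h1 := Finset.card_filter_add_card_filter_not (s := A) (c < ·)
    have h2 := Finset.card_filter_add_card_filter_not (s := B) (0 < ·)
    rw [hnotA] at h1
    rw [hnotB] at h2
    omega
  have hneg : ∀ b ∈ B.filter (· < 0), b < 0 := fun b hb => (Finset.mem_filter.1 hb).2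
  obtain ⟨f₁, hf₁, hfA₁, huniq₁⟩ := exists_isAcyclicOn_of_pos (A.filter (c < ·)) (B.filter (0 < ·)) hc
    fun b hb => (Finset.mem_filter.1 hb).2
  obtain ⟨f₂, hf₂, hfA₂, huniq₂⟩ := exists_isAcyclicOn_of_neg (A.filter (· ≤ c)) (B.filter (· < 0)) hc' hneg
  have hmem₁ : ∀ a ∈ A, c < a → f₁ a ∈ B ∧ 0 < f₁ a := fun a ha h => by
    simpa using hf₁.mapsTo (show a ∈ (A.filter (c < ·) : Set ℤ) by simpa using ⟨ha, h⟩)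
  have hmem₂ : ∀ a ∈ A, a ≤ c → f₂ a ∈ B ∧ f₂ a < 0 := fun a ha h => by
    have h' : f₂ a ∈ B.filter (· < 0) :=
      hf₂.mapsTo (Finset.mem_coe.2 (Finset.mem_filter.2 ⟨ha, h⟩))
    exact ⟨(Finset.mem_filter.1 h').1, hneg _ h'⟩
  set f : ℤ → ℤ := fun a => if c < a then f₁ a else f₂ a with hfdef
  have hfp : ∀ a, c < a → f a = f₁ a := fun a h => if_pos h
  have hfn : ∀ a, a ≤ c → f a = f₂ a := fun a h => if_neg (not_lt.2 h)
  have hmaps : Set.MapsTo f A B := fun a ha => by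
    rcases lt_or_ge c a with h | h
    · rw [hfp a h]; exact (hmem₁ a ha h).1
    · rw [hfn a h]; exact (hmem₂ a ha h).1
  have hpos : ∀ a ∈ A, c < a → 0 < f a := fun a ha h => hfp a h ▸ (hmem₁ a ha h).2
  have hneg' : ∀ a ∈ A, a ≤ c → f a < 0 := fun a ha h => hfn a h ▸ (hmem₂ a ha h).2
  have hsurj : Set.SurjOn f A B := fun b hb => by
    have hb0 : b ≠ 0 := fun h => hB0 (h ▸ hb)
    rcases lt_or_gt_of_ne hb0.symm with h | h
    · obtain ⟨a, ha, rfl⟩ := hf₁.surjOn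
        (Finset.mem_coe.2 (Finset.mem_filter.2 ⟨hb, h⟩))
      have ha := Finset.mem_filter.1 (Finset.mem_coe.1 ha)
      exact ⟨a, ha.1, hfp a ha.2⟩
    · obtain ⟨a, ha, rfl⟩ := hf₂.surjOn
        (Finset.mem_coe.2 (Finset.mem_filter.2 ⟨hb, h⟩))
      have ha := Finset.mem_filter.1 (Finset.mem_coe.1 ha)
      exact ⟨a, ha.1, hfn a ha.2⟩
  have hf : Set.BijOn f A B :=
    ⟨hmaps, Finset.injOn_of_surjOn_of_card_le f hmaps hsurj hcard.le, hsurj⟩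
  refine ⟨f, hf, fun a ha hmem => ?_, fun g hg hgA hm => ?_⟩
  · rcases lt_or_ge c a with h | h
    · have h1 := hpos a ha h
      rw [hfp a h] at h1 hmem
      exact hfA₁ a (Finset.mem_filter.2 ⟨ha, h⟩)
        (Finset.mem_filter.2 ⟨hmem, by omega⟩)
    · have h1 := hneg' a ha h
      rw [hfn a h] at h1 hmem
      exact hfA₂ a (Finset.mem_filter.2 ⟨ha, h⟩)
        (Finset.mem_filter.2 ⟨hmem, by omega⟩)
  · have hgp := Int.pos_of_map_add_eq hB0 hf hg hpos
      hneg' hm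
    obtain ⟨hg₁, hg₂⟩ := hg.filter_of_card_eq (c < ·) (0 < ·) hgp hc
    rw [hnotA, hnotB] at hg₂
    have hgn : ∀ a ∈ A, a ≤ c → g a < 0 := fun a ha h =>
      hneg _ (hg₂.mapsTo (Finset.mem_coe.2 (Finset.mem_filter.2 ⟨ha, h⟩)))
    have hrestrict : ∀ h : ℤ → ℤ, (∀ a ∈ A, c < a → 0 < h a) → (∀ a ∈ A, a ≤ c → h a < 0) →
        (A.filter (c < ·)).val.map (fun a => a + h a) =
          (A.val.map (fun a => a + h a)).filter (c < ·) ∧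
        (A.filter (· ≤ c)).val.map (fun a => a + h a) =
          (A.val.map (fun a => a + h a)).filter (· ≤ c) := by
      intro h hp hn
      have hiff : ∀ a ∈ A.val, (c < a ↔ c < a + h a) := fun a ha => by
        rcases lt_or_ge c a with hca | hca
        · have := hp a ha hca
          constructor <;> intro <;> omega
        · have := hn a ha hca
          constructor <;> intro <;> omega
      have hiff' : ∀ a ∈ A.val, (a ≤ c ↔ a + h a ≤ c) := fun a ha => by
        have := hiff a ha
        omega
      rw [Multiset.filter_map, Multiset.filter_map]
      constructor
      · rw [Finset.filter_val, Multiset.filter_congr hiff]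
        rfl
      · rw [Finset.filter_val, Multiset.filter_congr hiff']
        rfl
    have hrf := hrestrict f hpos hneg'
    have hrg := hrestrict g hgp hgn
    intro a ha
    rcases lt_or_ge c a with h | h
    · rw [hfp a h]
      refine huniq₁ g hg₁ (fun x hx hmem => hgA x (Finset.mem_filter.1 hx).1
        (Finset.mem_filter.1 hmem).1) ?_ (Finset.mem_coe.2 (Finset.mem_filter.2 ⟨ha, h⟩))
      rw [hrg.1, hm, ← hrf.1]
      exact Multiset.map_congr rfl fun x hx => by
        rw [hfp x (Finset.mem_filter.1 hx).2]
    · rw [hfn a h]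
      refine huniq₂ g hg₂ (fun x hx hmem => hgA x (Finset.mem_filter.1 hx).1
        (Finset.mem_filter.1 hmem).1) ?_ (Finset.mem_coe.2 (Finset.mem_filter.2 ⟨ha, h⟩))
      rw [hrg.2, hm, ← hrf.2]
      exact Multiset.map_congr rfl fun x hx => by
        rw [hfn x (Finset.mem_filter.1 hx).2]

/-- Dirichlet's simultaneous approximation theorem modulo `p`, with quality `1 / 4`. -/
theorem ZMod.exists_mul_valMinAbs_lt {p : ℕ} [NeZero p] (X : Finset (ZMod p))
    (hX : 4 ^ X.card < p) :
    ∃ t : ZMod p, t ≠ 0 ∧ ∀ x ∈ X, 4 * |(t * x).valMinAbs| < p := by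
  have hp : 0 < p := NeZero.pos p
  have hbox : ∀ y : ZMod p, 4 * y.val / p < 4 := fun y => by
    rw [Nat.div_lt_iff_lt_mul hp]
    have := y.val_lt
    omega
  let F : ZMod p → (X → Fin 4) := fun t x => ⟨4 * (t * x.1).val / p, hbox _⟩
  obtain ⟨s, t, hst, hF⟩ := Fintype.exists_ne_map_eq_of_card_lt F (by simpa [ZMod.card] using hX)
  refine ⟨s - t, sub_ne_zero.2 hst, fun x hx => ?_⟩
  have hq : 4 * (s * x).val / p = 4 * (t * x).val / p :=
    congrArg Fin.val (congrFun hF ⟨x, hx⟩)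
  have h1 := Nat.div_add_mod (4 * (s * x).val) p
  have h2 := Nat.div_add_mod (4 * (t * x).val) p
  have h3 := Nat.mod_lt (4 * (s * x).val) hp
  have h4 := Nat.mod_lt (4 * (t * x).val) hp
  rw [hq] at h1
  have hlt : 4 * |((s * x).val : ℤ) - (t * x).val| < p := by
    rcases abs_cases (((s * x).val : ℤ) - (t * x).val) with h | h <;> omega
  have hval : ((s - t) * x).valMinAbs = ((s * x).val : ℤ) - (t * x).val := by
    rw [ZMod.valMinAbs_spec]
    refine ⟨by simp [sub_mul], ?_⟩
    rw [Set.mem_Ioc]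
    rcases abs_cases (((s * x).val : ℤ) - (t * x).val) with h | h <;> constructor <;> omega
  rwa [hval]

/-- An injection that preserves the sums of elements of `A` and `B` and the membership of these
sums in `A` pulls acyclic matchings of integers back. -/
theorem exists_acyclic_matching_of_embedding {G : Type*} [AddCommGroup G] (A B : Finset G)
    (hcard : A.card = B.card) (hB0 : (0 : G) ∉ B) (φ : G → ℤ) (hφ : Function.Injective φ)
    (hφ0 : φ 0 = 0) (hadd : ∀ a ∈ A, ∀ b ∈ B, φ (a + b) = φ a + φ b) :
    ∃ f : A ≃ B, IsAcyclicMatchingFrom A B f := by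
  have hB0' : (0 : ℤ) ∉ B.image φ := fun h => by
    obtain ⟨b, hb, h⟩ := Finset.mem_image.1 h
    exact hB0 (hφ (h.trans hφ0.symm) ▸ hb)
  obtain ⟨F, hF, hFA, huniq⟩ := Int.exists_isAcyclicOn (A.image φ) (B.image φ)
    (by rw [Finset.card_image_of_injective _ hφ, Finset.card_image_of_injective _ hφ, hcard]) hB0'
  have hex : ∀ a : A, ∃ b : B, φ b = F (φ a) := fun a => by
    have : F (φ a) ∈ B.image φ := hF.mapsTo (Finset.mem_coe.2 (Finset.mem_image_of_mem φ a.2))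
    obtain ⟨b, hb, h⟩ := Finset.mem_image.1 this
    exact ⟨⟨b, hb⟩, h⟩
  choose f hf using hex
  have hfinj : Function.Injective f := fun a a' h => by
    have h' : F (φ a) = F (φ a') := by rw [← hf, ← hf, h]
    exact Subtype.ext (hφ (hF.injOn (Finset.mem_coe.2 (Finset.mem_image_of_mem φ a.2))
      (Finset.mem_coe.2 (Finset.mem_image_of_mem φ a'.2)) h'))
  have hfbij : Function.Bijective f :=
    (Fintype.bijective_iff_injective_and_card f).2 ⟨hfinj, by simpa using hcard⟩
  have hsum : ∀ (a : A) (b : B), φ (a + b) = φ a + φ b := fun a b => hadd a a.2 b b.2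
  have hmap : ∀ (g : A ≃ B) (H : ℤ → ℤ), (∀ a : A, H (φ a) = φ (g a)) →
      (A.image φ).val.map (fun x => x + H x) =
        (Finset.univ.val.map (fun a : A => (a : G) + (g a : G))).map φ := by
    intro g H hH
    rw [Finset.image_val_of_injOn hφ.injOn, Multiset.map_map, Multiset.map_map,
      Finset.univ_eq_attach, Finset.attach_val]
    conv_lhs => rw [← Multiset.attach_map_val A.val, Multiset.map_map]
    refine Multiset.map_congr rfl fun a _ => ?_
    have h1 := hH a
    have h2 := hsum a (g a)
    simp only [Function.comp_apply]
    rw [h2, ← h1]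
  refine ⟨Equiv.ofBijective f hfbij, fun a hmem => ?_, fun g hg hm => ?_⟩
  · refine hFA (φ a) (Finset.mem_image_of_mem _ a.2) ?_
    rw [← hf a, ← hsum]
    exact Finset.mem_image_of_mem _ hmem
  · have hmult : Finset.univ.val.map (fun a : A => (a : G) + (g a : G)) =
        Finset.univ.val.map
          (fun a : A => (a : G) + (Equiv.ofBijective f hfbij a : G)) := by
      classical
      have key : ∀ (h : A ≃ B) (x : G),
          (Finset.univ.val.map (fun a : A => (a : G) + (h a : G))).count x =
            multiplicityFn A B h x := by
        intro h x
        rw [multiplicityFn, Nat.card_eq_fintype_card, Fintype.card_subtype, Multiset.count_map]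
        simp only [eq_comm (a := x)]
        rfl
      ext x
      rw [key, key, hm]
    set H : ℤ → ℤ := Function.extend (fun a : A => φ a) (fun a => φ (g a)) 0 with hHdef
    have hH : ∀ a : A, H (φ a) = φ (g a) := fun a =>
      Function.Injective.extend_apply (fun a a' h => Subtype.ext (hφ h)) _ _ a
    have hHbij : Set.BijOn H (A.image φ) (B.image φ) := by
      refine ⟨fun x hx => ?_, fun x hx y hy hxy => ?_, fun y hy => ?_⟩
      · obtain ⟨a, ha, rfl⟩ := Finset.mem_image.1 (Finset.mem_coe.1 hx)
        rw [hH ⟨a, ha⟩]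
        exact Finset.mem_coe.2 (Finset.mem_image_of_mem _ (g _).2)
      · obtain ⟨a, ha, rfl⟩ := Finset.mem_image.1 (Finset.mem_coe.1 hx)
        obtain ⟨b, hb, rfl⟩ := Finset.mem_image.1 (Finset.mem_coe.1 hy)
        rw [hH ⟨a, ha⟩, hH ⟨b, hb⟩] at hxy
        have := g.injective (Subtype.ext (hφ hxy))
        rw [Subtype.mk.inj this]
      · obtain ⟨b, hb, rfl⟩ := Finset.mem_image.1 (Finset.mem_coe.1 hy)
        refine ⟨φ (g.symm ⟨b, hb⟩), Finset.mem_coe.2 (Finset.mem_image_of_mem _ (g.symm _).2), ?_⟩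
        rw [hH, Equiv.apply_symm_apply]
    have heq := huniq H hHbij (fun x hx hmem => by
        obtain ⟨a, ha, rfl⟩ := Finset.mem_image.1 hx
        rw [hH ⟨a, ha⟩, ← hsum ⟨a, ha⟩] at hmem
        obtain ⟨a', ha', h⟩ := Finset.mem_image.1 hmem
        exact hg ⟨a, ha⟩ (hφ h ▸ ha'))
      (by rw [hmap g H hH, hmap (Equiv.ofBijective f hfbij) F (fun a => (hf a).symm), hmult])
    ext a
    refine hφ ?_
    rw [← hH a, heq (Finset.mem_coe.2 (Finset.mem_image_of_mem _ a.2))]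
    exact (hf a).symm

theorem four_pow_lt_of_le_sqrt_logb {p k : ℕ} (hp : p.Prime) (hk0 : 0 < k)
    (hk : (k : ℝ) ≤ Real.sqrt (Real.logb 2 p) - 1) : 4 ^ (2 * k) < p := by
  have hlog : ((k : ℝ) + 1) ^ 2 ≤ Real.logb 2 p :=
    (Real.le_sqrt' (by positivity)).1 (by linarith)
  have hpow : 2 ^ ((k + 1) ^ 2) ≤ p := by
    have h := (Real.le_logb_iff_rpow_le one_lt_two (by exact_mod_cast hp.pos)).1 hlog
    have h' : ((2 : ℝ) ^ ((k + 1) ^ 2 : ℕ)) ≤ p := by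
      rw [← Real.rpow_natCast]
      simpa using h
    exact_mod_cast h'
  have hle : 4 ^ (2 * k) ≤ p := by
    refine le_trans ?_ hpow
    rw [show (4 : ℕ) = 2 ^ 2 by norm_num, ← pow_mul]
    refine Nat.pow_le_pow_right (by norm_num) ?_
    zify
    nlinarith [sq_nonneg ((k : ℤ) - 1)]
  refine hle.lt_of_ne fun h => ?_
  exact Nat.Prime.not_prime_pow (by omega : 2 ≤ 2 * k) (h ▸ hp)

/-- Let `p` be a prime and `A, B` nonempty subsets of `ℤ/pℤ` with `0 ∉ B`
and `|A| = |B| = k`, where `k ≤ √(log₂ p) − 1`. Then there exists an acyclic matching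
from `A` to `B`. -/
theorem small_sets_acyclic_matching (p : ℕ) (hp : p.Prime)
    (A B : Finset (ZMod p)) (hA : A.Nonempty) (hB : B.Nonempty)
    (hB0 : (0 : ZMod p) ∉ B) (k : ℕ) (hAk : A.card = k) (hBk : B.card = k)
    (hk : (k : ℝ) ≤ Real.sqrt (Real.logb 2 p) - 1) :
    ∃ f : A ≃ B, IsAcyclicMatchingFrom A B f := by
  subst hBk
  have hlt := four_pow_lt_of_le_sqrt_logb hp hB.card_pos hk
  have : Fact p.Prime := ⟨hp⟩
  obtain ⟨t, ht, hsmall⟩ := ZMod.exists_mul_valMinAbs_lt (A ∪ B) (lt_of_le_of_lt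
    (Nat.pow_le_pow_right (by norm_num) ((Finset.card_union_le A B).trans (by omega))) hlt)
  refine exists_acyclic_matching_of_embedding A B hAk hB0 (fun x => (t * x).valMinAbs)
    (fun x y h => mul_left_cancel₀ ht (ZMod.injective_valMinAbs h)) (by simp) fun a ha b hb => ?_
  have h1 := hsmall a (Finset.mem_union_left _ ha)
  have h2 := hsmall b (Finset.mem_union_right _ hb)
  rw [ZMod.valMinAbs_spec]
  refine ⟨by simp [mul_add], ?_⟩
  rw [Set.mem_Ioc]
  rcases abs_cases (t * a).valMinAbs with h | h <;>
    rcases abs_cases (t * b).valMinAbs with h' | h' <;> constructor <;> omega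
end
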